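/- arXiv:math/0604201 — 2 statements merged into one kernel-verified Lean document; each statement's English description precedes it below -/
import Mathlib

section
/- Let A be a positive semidefinite n×n complex matrix and let V be an n×d complex matrix with V*V = I_d. Then for every integer k with 1 ≤ k ≤ d, the map p ↦ λ_k( (V* A^p V)^{1/p} ) is nondecreasing on (0,∞), where λ_k denotes the k-th largest eigenvalue counted with multiplicity. -/
open Matrix ComplexOrder

/-- Functional calculus: apply `f : ℝ → ℝ` to a Hermitian matrix via its spectral
decomposition `A = Σ λ_k u_k u_k*`, i.e. `f(A) = Σ f(λ_k) u_k u_k*`;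
junk value `0` if the matrix is not Hermitian. -/
noncomputable def matFun {n : ℕ} (A : Matrix (Fin n) (Fin n) ℂ) (f : ℝ → ℝ) :
    Matrix (Fin n) (Fin n) ℂ :=
  if h : A.IsHermitian then
    (h.eigenvectorUnitary : Matrix (Fin n) (Fin n) ℂ) *
      Matrix.diagonal (fun i => (f (h.eigenvalues i) : ℂ)) *
      star (h.eigenvectorUnitary : Matrix (Fin n) (Fin n) ℂ)
  else 0


/-- The `k`-th largest eigenvalue (`k` is 0-indexed, eigenvalues counted with
multiplicity) of a Hermitian matrix; junk value `0` if the matrix is not Hermitian. -/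
noncomputable def kthEig {n : ℕ} (M : Matrix (Fin n) (Fin n) ℂ) (k : Fin n) : ℝ :=
  if h : M.IsHermitian then (h.eigenvalues ∘ Tuple.sort h.eigenvalues) k.rev else 0

/-- The quadratic form of a matrix diagonalized as `U diag(μ) Uᴴ`. -/
lemma dotProduct_conj_diagonal_mulVec {m n : ℕ} (U : Matrix (Fin m) (Fin n) ℂ) (μ : Fin n → ℝ)
    (x : Fin m → ℂ) :
    star x ⬝ᵥ ((U * diagonal (fun i => (μ i : ℂ)) * Uᴴ) *ᵥ x) =
      ((∑ i, μ i * Complex.normSq ((Uᴴ *ᵥ x) i) : ℝ) : ℂ) := by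
  have hstar : star x ᵥ* U = star (Uᴴ *ᵥ x) := by
    rw [star_mulVec, conjTranspose_conjTranspose]
  rw [← mulVec_mulVec, ← mulVec_mulVec, dotProduct_mulVec, hstar, dotProduct,
    Complex.ofReal_sum]
  refine Finset.sum_congr rfl fun i _ => ?_
  rw [mulVec_diagonal, Pi.star_apply, Complex.ofReal_mul, Complex.normSq_eq_conj_mul_self]
  simp only [RCLike.star_def]
  ring

lemma sum_normSq_conjTranspose_mulVec {m n : ℕ} {U : Matrix (Fin m) (Fin n) ℂ} (hU : U * Uᴴ = 1)
    (x : Fin m → ℂ) :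
    ∑ i, Complex.normSq ((Uᴴ *ᵥ x) i) = ∑ i, Complex.normSq (x i) := by
  have h := dotProduct_conj_diagonal_mulVec U 1 x
  have hone := dotProduct_conj_diagonal_mulVec (1 : Matrix (Fin m) (Fin m) ℂ) 1 x
  simp only [Pi.one_apply, Complex.ofReal_one, one_mul, diagonal_one, Matrix.mul_one, hU,
    conjTranspose_one, one_mulVec] at h hone
  exact_mod_cast h.symm.trans hone

/-- Courant–Fischer dimension count: a nonzero vector whose coordinates in two given unitary bases
are supported, respectively, on the sorted indices `≥ r` and `≤ r`. -/
lemma exists_common_rayleigh_vector {d : ℕ} {U W : Matrix (Fin d) (Fin d) ℂ} (hU : U * Uᴴ = 1)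
    (hW : W * Wᴴ = 1) {μ ν : Fin d → ℝ} {σ τ : Equiv.Perm (Fin d)} (hσ : Monotone (μ ∘ σ))
    (hτ : Monotone (ν ∘ τ)) (r : Fin d) :
    ∃ x : Fin d → ℂ, 0 < ∑ i, Complex.normSq (x i) ∧
      μ (σ r) * ∑ i, Complex.normSq (x i) ≤ ∑ i, μ i * Complex.normSq ((Uᴴ *ᵥ x) i) ∧
      ∑ i, ν i * Complex.normSq ((Wᴴ *ᵥ x) i) ≤ ν (τ r) * ∑ i, Complex.normSq (x i) := by
  let B : Matrix (Fin d) (Fin d) ℂ :=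
    fun i => if i < r then Uᴴ (σ i) else if i = r then 0 else Wᴴ (τ i)
  have hB : B.det = 0 := det_eq_zero_of_row_eq_zero r fun j => by simp [B]
  obtain ⟨x, hx, hBx⟩ := exists_mulVec_eq_zero_iff.2 hB
  have hlow : ∀ i < r, (Uᴴ *ᵥ x) (σ i) = 0 := fun i hi => by
    have := congrFun hBx i
    simpa [B, mulVec, hi] using this
  have hhigh : ∀ i, r < i → (Wᴴ *ᵥ x) (τ i) = 0 := fun i hi => by
    have := congrFun hBx i
    simpa [B, mulVec, hi.not_gt, hi.ne'] using this
  refine ⟨x, ?_, ?_, ?_⟩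
  · obtain ⟨i, hi⟩ := Function.ne_iff.1 hx
    exact Finset.sum_pos' (fun _ _ => Complex.normSq_nonneg _)
      ⟨i, Finset.mem_univ i, Complex.normSq_pos.2 hi⟩
  · rw [← sum_normSq_conjTranspose_mulVec hU, Finset.mul_sum,
      ← Equiv.sum_comp σ (fun i => μ (σ r) * Complex.normSq ((Uᴴ *ᵥ x) i)),
      ← Equiv.sum_comp σ (fun i => μ i * Complex.normSq ((Uᴴ *ᵥ x) i))]
    refine Finset.sum_le_sum fun i _ => ?_
    rcases lt_or_ge i r with hi | hi
    · simp [hlow i hi]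
    · exact mul_le_mul_of_nonneg_right (hσ hi) (Complex.normSq_nonneg _)
  · rw [← sum_normSq_conjTranspose_mulVec hW, Finset.mul_sum,
      ← Equiv.sum_comp τ (fun i => ν (τ r) * Complex.normSq ((Wᴴ *ᵥ x) i)),
      ← Equiv.sum_comp τ (fun i => ν i * Complex.normSq ((Wᴴ *ᵥ x) i))]
    refine Finset.sum_le_sum fun i _ => ?_
    rcases lt_or_ge r i with hi | hi
    · simp [hhigh i hi]
    · exact mul_le_mul_of_nonneg_right (hτ hi) (Complex.normSq_nonneg _)

/-- The sorted eigenvalues do not depend on the chosen diagonalization. -/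
lemma sorted_diagonal_le_of_eq {d : ℕ} {U W : Matrix (Fin d) (Fin d) ℂ} (hU : U * Uᴴ = 1)
    (hW : W * Wᴴ = 1) {μ ν : Fin d → ℝ} {σ τ : Equiv.Perm (Fin d)} (hσ : Monotone (μ ∘ σ))
    (hτ : Monotone (ν ∘ τ))
    (h : U * diagonal (fun i => (μ i : ℂ)) * Uᴴ = W * diagonal (fun i => (ν i : ℂ)) * Wᴴ)
    (r : Fin d) : μ (σ r) ≤ ν (τ r) := by
  obtain ⟨x, hx, h₁, h₂⟩ := exists_common_rayleigh_vector hU hW hσ hτ r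
  have hq := dotProduct_conj_diagonal_mulVec U μ x
  rw [h, dotProduct_conj_diagonal_mulVec W ν x, Complex.ofReal_inj] at hq
  exact le_of_mul_le_mul_right (h₁.trans (hq ▸ h₂)) hx

lemma eigenvectorUnitary_mul_conjTranspose {d : ℕ} {M : Matrix (Fin d) (Fin d) ℂ}
    (hM : M.IsHermitian) :
    (hM.eigenvectorUnitary : Matrix (Fin d) (Fin d) ℂ) *
      (hM.eigenvectorUnitary : Matrix (Fin d) (Fin d) ℂ)ᴴ = 1 :=
  Unitary.coe_mul_star_self hM.eigenvectorUnitary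

lemma eigenvectorUnitary_mul_diagonal_mul {d : ℕ} {M : Matrix (Fin d) (Fin d) ℂ}
    (hM : M.IsHermitian) :
    (hM.eigenvectorUnitary : Matrix (Fin d) (Fin d) ℂ) *
      diagonal (fun i => (hM.eigenvalues i : ℂ)) *
      (hM.eigenvectorUnitary : Matrix (Fin d) (Fin d) ℂ)ᴴ = M := by
  conv_rhs => rw [hM.spectral_theorem, Unitary.conjStarAlgAut_apply]
  rfl

lemma matFun_of_isHermitian {d : ℕ} {M : Matrix (Fin d) (Fin d) ℂ} (hM : M.IsHermitian)
    (f : ℝ → ℝ) :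
    matFun M f = (hM.eigenvectorUnitary : Matrix (Fin d) (Fin d) ℂ) *
      diagonal (fun i => (f (hM.eigenvalues i) : ℂ)) *
      (hM.eigenvectorUnitary : Matrix (Fin d) (Fin d) ℂ)ᴴ :=
  dif_pos hM

lemma matFun_isHermitian {d : ℕ} {M : Matrix (Fin d) (Fin d) ℂ} (hM : M.IsHermitian)
    (f : ℝ → ℝ) : (matFun M f).IsHermitian := by
  rw [matFun_of_isHermitian hM]
  exact isHermitian_mul_mul_conjTranspose _ <| by
    rw [IsHermitian, diagonal_conjTranspose]
    congr 1
    ext i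
    simp

lemma matFun_posSemidef {d : ℕ} {M : Matrix (Fin d) (Fin d) ℂ} (hM : M.PosSemidef)
    {f : ℝ → ℝ} (hf : ∀ x, 0 ≤ x → 0 ≤ f x) : (matFun M f).PosSemidef := by
  rw [matFun_of_isHermitian hM.1]
  refine PosSemidef.mul_mul_conjTranspose_same ?_ _
  rw [posSemidef_diagonal_iff]
  exact fun i => Complex.zero_le_real.2 (hf _ (hM.eigenvalues_nonneg i))

lemma kthEig_of_isHermitian {d : ℕ} {M : Matrix (Fin d) (Fin d) ℂ} (hM : M.IsHermitian)
    (k : Fin d) : kthEig M k = hM.eigenvalues (Tuple.sort hM.eigenvalues k.rev) := by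
  rw [kthEig, dif_pos hM, Function.comp_apply]

lemma kthEig_nonneg {d : ℕ} {M : Matrix (Fin d) (Fin d) ℂ} (hM : M.PosSemidef) (k : Fin d) :
    0 ≤ kthEig M k := by
  rw [kthEig_of_isHermitian hM.1]
  exact hM.eigenvalues_nonneg _

/-- The spectral mapping theorem for ordered eigenvalues. -/
lemma kthEig_matFun {d : ℕ} {M : Matrix (Fin d) (Fin d) ℂ} (hM : M.PosSemidef)
    {f : ℝ → ℝ} (hf : MonotoneOn f (Set.Ici 0)) (k : Fin d) :
    kthEig (matFun M f) k = f (kthEig M k) := by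
  have hfM := matFun_isHermitian hM.1 f
  have hmono : Monotone ((f ∘ hM.1.eigenvalues) ∘ Tuple.sort hM.1.eigenvalues) := fun i j hij =>
    hf (hM.eigenvalues_nonneg _) (hM.eigenvalues_nonneg _)
      (Tuple.monotone_sort hM.1.eigenvalues hij)
  have heq := (eigenvectorUnitary_mul_diagonal_mul hfM).trans (matFun_of_isHermitian hM.1 f)
  rw [kthEig_of_isHermitian hfM, kthEig_of_isHermitian hM.1]
  apply le_antisymm
  · exact sorted_diagonal_le_of_eq (eigenvectorUnitary_mul_conjTranspose hfM)
      (eigenvectorUnitary_mul_conjTranspose hM.1) (Tuple.monotone_sort _) hmono heq k.rev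
  · exact sorted_diagonal_le_of_eq (eigenvectorUnitary_mul_conjTranspose hM.1)
      (eigenvectorUnitary_mul_conjTranspose hfM) hmono (Tuple.monotone_sort _) heq.symm k.rev

/-- Comparison of two ordered eigenvalues through the Rayleigh quotients of a common vector. -/
lemma exists_kthEig_le_rayleigh {d : ℕ} {M N : Matrix (Fin d) (Fin d) ℂ} (hM : M.IsHermitian)
    (hN : N.IsHermitian) (k : Fin d) :
    ∃ x : Fin d → ℂ, 0 < ∑ i, Complex.normSq (x i) ∧
      kthEig M k * ∑ i, Complex.normSq (x i) ≤ (star x ⬝ᵥ (M *ᵥ x)).re ∧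
      (star x ⬝ᵥ (N *ᵥ x)).re ≤ kthEig N k * ∑ i, Complex.normSq (x i) := by
  obtain ⟨x, hx, h₁, h₂⟩ := exists_common_rayleigh_vector
    (eigenvectorUnitary_mul_conjTranspose hM) (eigenvectorUnitary_mul_conjTranspose hN)
    (Tuple.monotone_sort hM.eigenvalues) (Tuple.monotone_sort hN.eigenvalues) k.rev
  have hqM := dotProduct_conj_diagonal_mulVec
    (hM.eigenvectorUnitary : Matrix (Fin d) (Fin d) ℂ) hM.eigenvalues x
  have hqN := dotProduct_conj_diagonal_mulVec
    (hN.eigenvectorUnitary : Matrix (Fin d) (Fin d) ℂ) hN.eigenvalues x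
  rw [eigenvectorUnitary_mul_diagonal_mul] at hqM hqN
  refine ⟨x, hx, ?_, ?_⟩
  · rwa [hqM, Complex.ofReal_re, kthEig_of_isHermitian hM]
  · rwa [hqN, Complex.ofReal_re, kthEig_of_isHermitian hN]

/-- The Jensen inequality for powers, with weights of arbitrary positive total mass. -/
lemma rpow_weighted_mean_le {ι : Type*} (s : Finset ι) {w a : ι → ℝ} (hw : ∀ i ∈ s, 0 ≤ w i)
    (hpos : 0 < ∑ i ∈ s, w i) (ha : ∀ i ∈ s, 0 ≤ a i) {p q : ℝ} (hp : 0 < p) (hpq : p ≤ q) :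
    ((∑ i ∈ s, a i ^ p * w i) / ∑ i ∈ s, w i) ^ (q / p) ≤
      (∑ i ∈ s, a i ^ q * w i) / ∑ i ∈ s, w i := by
  have h := Real.rpow_arith_mean_le_arith_mean_rpow s (fun i => w i / ∑ j ∈ s, w j)
    (fun i => a i ^ p) (fun i hi => div_nonneg (hw i hi) hpos.le)
    (by rw [← Finset.sum_div, div_self hpos.ne'])
    (fun i hi => Real.rpow_nonneg (ha i hi) _) ((one_le_div hp).2 hpq)
  rw [Finset.sum_div, Finset.sum_div]
  convert h using 2
  · exact Finset.sum_congr rfl fun i _ => by ring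
  · rename_i i hi
    rw [← Real.rpow_mul (ha i hi), mul_div_cancel₀ _ hp.ne']
    ring

/-- for a positive semidefinite `A` and an isometry `V`, the map
`p ↦ λ_k((Vᴴ Aᵖ V)^(1/p))` is nondecreasing on `(0,∞)`. -/
theorem kth_eigenvalue_compressed_power_monotone {n d : ℕ}
    (A : Matrix (Fin n) (Fin n) ℂ) (hA : A.PosSemidef)
    (V : Matrix (Fin n) (Fin d) ℂ) (hV : Vᴴ * V = 1) (k : Fin d) :
    ∀ p q : ℝ, 0 < p → p ≤ q →
      kthEig (matFun (Vᴴ * matFun A (fun x => x ^ p) * V) (fun x => x ^ (1 / p))) k ≤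
      kthEig (matFun (Vᴴ * matFun A (fun x => x ^ q) * V) (fun x => x ^ (1 / q))) k := by
  intro p q hp hpq
  have hq : 0 < q := hp.trans_le hpq
  have hM (s : ℝ) : (Vᴴ * matFun A (fun x => x ^ s) * V).PosSemidef :=
    (matFun_posSemidef hA fun x hx => Real.rpow_nonneg hx s).conjTranspose_mul_mul_same V
  have hmono {s : ℝ} (hs : 0 < s) : MonotoneOn (fun x : ℝ => x ^ (1 / s)) (Set.Ici 0) :=
    fun x hx y _ hxy => Real.rpow_le_rpow hx hxy (one_div_pos.2 hs).le
  rw [kthEig_matFun (hM p) (hmono hp), kthEig_matFun (hM q) (hmono hq)]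
  obtain ⟨x, hx, h₁, h₂⟩ := exists_kthEig_le_rayleigh (hM p).1 (hM q).1 k
  have hμ := kthEig_nonneg (hM p) k
  set μ := kthEig (Vᴴ * matFun A (fun x => x ^ p) * V) k
  set ν := kthEig (Vᴴ * matFun A (fun x => x ^ q) * V) k
  set U := (hA.1.eigenvectorUnitary : Matrix (Fin n) (Fin n) ℂ) with hU
  have hform (s : ℝ) : (star x ⬝ᵥ ((Vᴴ * matFun A (fun x => x ^ s) * V) *ᵥ x)).re =
      ∑ i, hA.1.eigenvalues i ^ s * Complex.normSq (((Vᴴ * U)ᴴ *ᵥ x) i) := by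
    rw [← Complex.ofReal_re (∑ i, _), ← dotProduct_conj_diagonal_mulVec (Vᴴ * U)
      (fun i => hA.1.eigenvalues i ^ s) x, matFun_of_isHermitian hA.1]
    simp only [conjTranspose_mul, conjTranspose_conjTranspose, Matrix.mul_assoc, hU]
  have hVU : (Vᴴ * U) * (Vᴴ * U)ᴴ = 1 := by
    rw [conjTranspose_mul, conjTranspose_conjTranspose, Matrix.mul_assoc, ← Matrix.mul_assoc U,
      eigenvectorUnitary_mul_conjTranspose hA.1, Matrix.one_mul, hV]
  rw [hform, ← sum_normSq_conjTranspose_mulVec hVU] at h₁ h₂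
  rw [← sum_normSq_conjTranspose_mulVec hVU] at hx
  have hpow : μ ^ (q / p) ≤ ν :=
    (Real.rpow_le_rpow hμ ((le_div_iff₀ hx).2 h₁) (div_pos hq hp).le).trans
      ((rpow_weighted_mean_le Finset.univ (fun i _ => Complex.normSq_nonneg _) hx
        (fun i _ => hA.eigenvalues_nonneg i) hp hpq).trans ((div_le_iff₀ hx).2 h₂))
  calc μ ^ (1 / p) = (μ ^ (q / p)) ^ (1 / q) := by
        rw [← Real.rpow_mul hμ]
        congr 1
        field_simp
    _ ≤ ν ^ (1 / q) := Real.rpow_le_rpow (Real.rpow_nonneg hμ _) hpow (one_div_pos.2 hq).le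
end

section
/- (Hansen–Pedersen trace inequality) Let f be a convex real function defined on an interval [a,b], let A_1, …, A_m be n×n Hermitian complex matrices whose spectra lie in [a,b], and let Z_1, …, Z_m be n×n complex matrices with Σ_{i=1}^m Z_i* Z_i = I. Then Tr f(Σ_i Z_i* A_i Z_i) ≤ Tr (Σ_i Z_i* f(A_i) Z_i). -/
open Matrix ComplexOrder

theorem matFun_eq {n : ℕ} {A : Matrix (Fin n) (Fin n) ℂ} (hA : A.IsHermitian) (f : ℝ → ℝ) :
    matFun A f = (hA.eigenvectorUnitary : Matrix (Fin n) (Fin n) ℂ) *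
      Matrix.diagonal (fun i => (f (hA.eigenvalues i) : ℂ)) *
      star (hA.eigenvectorUnitary : Matrix (Fin n) (Fin n) ℂ) :=
  dif_pos hA

theorem matFun_id {n : ℕ} {A : Matrix (Fin n) (Fin n) ℂ} (hA : A.IsHermitian) :
    matFun A id = A := by
  conv_rhs => rw [hA.spectral_theorem, Unitary.conjStarAlgAut_apply]
  exact matFun_eq hA id

theorem matFun_one {n : ℕ} {A : Matrix (Fin n) (Fin n) ℂ} (hA : A.IsHermitian) :
    matFun A (fun _ => 1) = 1 := by
  simp [matFun_eq hA]

theorem trace_matFun {n : ℕ} {A : Matrix (Fin n) (Fin n) ℂ} (hA : A.IsHermitian) (f : ℝ → ℝ) :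
    (matFun A f).trace = ((∑ k, f (hA.eigenvalues k) : ℝ) : ℂ) := by
  rw [matFun_eq hA, Matrix.trace_mul_cycle]
  simp [Matrix.trace_diagonal]

theorem conjTranspose_mul_diagonal_mul_apply_self {m n : Type*} [Fintype m] [DecidableEq m]
    (V : Matrix m n ℂ) (d : m → ℝ) (k : n) :
    (Vᴴ * Matrix.diagonal (fun j => (d j : ℂ)) * V) k k =
      ((∑ j, Complex.normSq (V j k) * d j : ℝ) : ℂ) := by
  rw [Matrix.mul_apply]
  push_cast
  refine Finset.sum_congr rfl fun j _ => ?_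
  rw [Matrix.mul_diagonal, Matrix.conjTranspose_apply, Complex.normSq_eq_conj_mul_self]
  simp only [starRingEnd_apply]
  ring

/-- The diagonal entries of a compression of `∑ i, Zᵢᴴ g(Aᵢ) Zᵢ` are combinations of the values
of `g` at the eigenvalues of the `Aᵢ`, with weights not depending on `g`. -/
theorem conj_sum_matFun_apply_self {n m : ℕ} {A : Fin m → Matrix (Fin n) (Fin n) ℂ}
    (hA : ∀ i, (A i).IsHermitian) (Z : Fin m → Matrix (Fin n) (Fin n) ℂ)
    (W : Matrix (Fin n) (Fin n) ℂ) (g : ℝ → ℝ) (k : Fin n) :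
    (Wᴴ * (∑ i, (Z i)ᴴ * matFun (A i) g * Z i) * W) k k =
      ((∑ p : Fin m × Fin n, Complex.normSq
        ((star ((hA p.1).eigenvectorUnitary : Matrix (Fin n) (Fin n) ℂ) * Z p.1 * W) p.2 k) *
          g ((hA p.1).eigenvalues p.2) : ℝ) : ℂ) := by
  rw [Fintype.sum_prod_type, Complex.ofReal_sum, Finset.mul_sum, Finset.sum_mul, Matrix.sum_apply]
  refine Finset.sum_congr rfl fun i _ => ?_
  refine Eq.trans ?_ (conjTranspose_mul_diagonal_mul_apply_self
    (star ((hA i).eigenvectorUnitary : Matrix (Fin n) (Fin n) ℂ) * Z i * W)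
    (fun j => g ((hA i).eigenvalues j)) k)
  simp only [matFun_eq (hA i), Matrix.star_eq_conjTranspose, Matrix.conjTranspose_mul,
    Matrix.conjTranspose_conjTranspose, Matrix.mul_assoc]

/-- Hansen–Pedersen: for a convex `f` on `[a,b]`, Hermitian `A_i` with
spectra in `[a,b]` and an isometric column `{Z_i}`,
`Tr f(Σ Z_iᴴ A_i Z_i) ≤ Tr (Σ Z_iᴴ f(A_i) Z_i)`. -/
theorem hansen_pedersen_trace {n m : ℕ} {a b : ℝ} {f : ℝ → ℝ}
    (hconv : ConvexOn ℝ (Set.Icc a b) f)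
    (A : Fin m → Matrix (Fin n) (Fin n) ℂ) (hA : ∀ i, (A i).IsHermitian)
    (hspec : ∀ i j, (hA i).eigenvalues j ∈ Set.Icc a b)
    (Z : Fin m → Matrix (Fin n) (Fin n) ℂ) (hZ : ∑ i, (Z i)ᴴ * Z i = 1) :
    (matFun (∑ i, (Z i)ᴴ * A i * Z i) f).trace ≤
      (∑ i, (Z i)ᴴ * matFun (A i) f * Z i).trace := by
  have hB : (∑ i, (Z i)ᴴ * A i * Z i).IsHermitian :=
    isSelfAdjoint_sum _ fun i _ => Matrix.isHermitian_conjTranspose_mul_mul (Z i) (hA i)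
  set W : Matrix (Fin n) (Fin n) ℂ := (hB.eigenvectorUnitary : Matrix (Fin n) (Fin n) ℂ) with hW
  have hWW : Wᴴ * W = 1 := Unitary.coe_star_mul_self hB.eigenvectorUnitary
  have hWW' : W * Wᴴ = 1 := Unitary.coe_mul_star_self hB.eigenvectorUnitary
  set w : Fin n → Fin m × Fin n → ℝ := fun k p => Complex.normSq
    ((star ((hA p.1).eigenvectorUnitary : Matrix (Fin n) (Fin n) ℂ) * Z p.1 * W) p.2 k)
  have key (g : ℝ → ℝ) (k : Fin n) : (Wᴴ * (∑ i, (Z i)ᴴ * matFun (A i) g * Z i) * W) k k =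
      ((∑ p : Fin m × Fin n, w k p * g ((hA p.1).eigenvalues p.2) : ℝ) : ℂ) :=
    conj_sum_matFun_apply_self hA Z W g k
  have hw_sum (k : Fin n) : ∑ p, w k p = 1 := by
    have h := key (fun _ => 1) k
    simp only [matFun_one (hA _), mul_one, hZ, hWW, Matrix.one_apply_eq] at h
    exact_mod_cast h.symm
  have hw_mean (k : Fin n) :
      ∑ p, w k p * (hA p.1).eigenvalues p.2 = hB.eigenvalues k := by
    have h := key id k
    simp only [matFun_id (hA _), id] at h
    have hdiag : Wᴴ * (∑ i, (Z i)ᴴ * A i * Z i) * W =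
        Matrix.diagonal (fun k => (hB.eigenvalues k : ℂ)) := by
      conv_lhs => rw [← matFun_id hB, matFun_eq hB, ← hW, Matrix.star_eq_conjTranspose]
      simp only [Matrix.mul_assoc, hWW, Matrix.mul_one, id]
      rw [← Matrix.mul_assoc, hWW, Matrix.one_mul]
    rw [hdiag, Matrix.diagonal_apply_eq] at h
    exact_mod_cast h.symm
  have htrace : (∑ i, (Z i)ᴴ * matFun (A i) f * Z i).trace =
      ((∑ k, ∑ p, w k p * f ((hA p.1).eigenvalues p.2) : ℝ) : ℂ) := by
    rw [← Matrix.mul_one (∑ i, (Z i)ᴴ * matFun (A i) f * Z i), ← hWW', ← Matrix.mul_assoc,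
      Matrix.trace_mul_comm, ← Matrix.mul_assoc, Complex.ofReal_sum]
    exact Finset.sum_congr rfl fun k _ => key f k
  rw [trace_matFun hB, htrace, Complex.real_le_real]
  refine Finset.sum_le_sum fun k _ => ?_
  rw [← hw_mean k]
  exact hconv.map_sum_le (fun p _ => Complex.normSq_nonneg _) (hw_sum k)
    fun p _ => hspec p.1 p.2
end
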